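/- arXiv:1903.00465 — 14 statements merged into one kernel-verified Lean document; each statement's English description precedes it below -/
import Mathlib

section
/- Let a, b, c be nonzero real numbers and let {w_n} be the bi-periodic Horadam sequence with initial values w_0, w_1, and let {u_n} be the bi-periodic Fibonacci sequence (same a, b, c). Then for every integer n ≥ 1, w_n = u_n·w_1 + c·(b/a)^{ξ(n)}·u_{n-1}·w_0, where ξ(n) = n mod 2. -/
/-- The bi-periodic Horadam sequence with parameters `a, b, c` and
initial values `w0, w1`. -/
def biper (a b c w0 w1 : ℝ) : ℕ → ℝ
  | 0 => w0
  | 1 => w1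
  | n + 2 => (if Even (n + 2) then a else b) * biper a b c w0 w1 (n + 1)
      + c * biper a b c w0 w1 n

/-- The parity function ξ. -/
def xi (n : ℕ) : ℕ := n % 2

/-- Splitting off the initial values, with the index shifted by one. -/
theorem biper_succ (a b c w0 w1 : ℝ) (ha : a ≠ 0) (n : ℕ) :
    biper a b c w0 w1 (n + 1) =
      biper a b c 0 1 (n + 1) * w1 + c * (b / a) ^ xi (n + 1) * biper a b c 0 1 n * w0 := by
  induction n using Nat.twoStepInduction with
  | zero => simp [biper]
  | one => simp [biper, xi]
  | more k ih₀ ih₁ =>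
    rw [biper, ih₀, ih₁, biper.eq_3 a b c 0 1 (k + 1), biper.eq_3 a b c 0 1 k]
    rcases Nat.even_or_odd k with hk | hk
    · have h₁ : (k + 1) % 2 = 1 := by grind
      have h₂ : (k + 1 + 1) % 2 = 0 := by grind
      have h₃ : (k + 2 + 1) % 2 = 1 := by grind
      have h₄ : Even (k + 2) := by grind
      have h₅ : ¬ Even (k + 1 + 2) := by grind
      simp only [xi, h₁, h₂, h₃, h₄, h₅, if_true, if_false]
      field_simp
      ring
    · have h₁ : (k + 1) % 2 = 0 := by grind
      have h₂ : (k + 1 + 1) % 2 = 1 := by grind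
      have h₃ : (k + 2 + 1) % 2 = 0 := by grind
      have h₄ : ¬ Even (k + 2) := by grind
      have h₅ : Even (k + 1 + 2) := by grind
      simp only [xi, h₁, h₂, h₃, h₄, h₅, if_true, if_false]
      field_simp
      ring

theorem stmt0 (a b c w0 w1 : ℝ) (ha : a ≠ 0) (hb : b ≠ 0) (hc : c ≠ 0)
    (n : ℕ) (hn : 1 ≤ n) :
    biper a b c w0 w1 n =
      biper a b c 0 1 n * w1 + c * (b / a) ^ xi n * biper a b c 0 1 (n - 1) * w0 := by
  obtain ⟨m, rfl⟩ := Nat.exists_eq_add_of_le' hn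
  exact biper_succ a b c w0 w1 ha m
end

section
/- Let a, b, c be positive real numbers, set α = (ab + √(a²b² + 4abc))/2 and β = (ab − √(a²b² + 4abc))/2 (the roots of x² − ab·x − abc), and let {w_n} be the bi-periodic Horadam sequence with initial values w_0, w_1. Then for every integer n ≥ 1, w_n = (a^{ξ(n+1)} / (ab)^{⌊n/2⌋}) · (A·α^n − B·β^n), where A = (w_1 − (β/a)·w_0)/(α − β) and B = (w_1 − (α/a)·w_0)/(α − β). -/
/-- Rescaling a solution of `u (n + 2) = a b u (n + 1) + a b c u n` by parity-dependent factors
gives a bi-periodic Horadam sequence. -/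
theorem biper_eq_of_linear_recurrence {a b c : ℝ} (ha : a ≠ 0) (hb : b ≠ 0) {u : ℕ → ℝ}
    (hu : ∀ n, u (n + 2) = a * b * u (n + 1) + a * b * c * u n) (n : ℕ) :
    biper a b c (a * u 0) (u 1) n = a ^ xi (n + 1) / (a * b) ^ (n / 2) * u n := by
  induction n using Nat.twoStepInduction with
  | zero => simp [biper, xi]
  | one => simp [biper, xi]
  | more n ih₀ ih₁ =>
    rw [biper, ih₀, ih₁, hu]
    rcases Nat.even_or_odd' n with ⟨k, rfl | rfl⟩
    · have h₁ : xi (2 * k + 1) = 1 := by unfold xi; omega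
      have h₂ : xi (2 * k + 1 + 1) = 0 := by unfold xi; omega
      have h₃ : xi (2 * k + 2 + 1) = 1 := by unfold xi; omega
      have h₄ : (2 * k + 1) / 2 = k := by omega
      have h₅ : (2 * k + 2) / 2 = k + 1 := by omega
      have h₆ : 2 * k / 2 = k := by omega
      have h₇ : Even (2 * k + 2) := by grind
      rw [h₁, h₂, h₃, h₄, h₅, h₆, if_pos h₇]
      field_simp
      ring
    · have h₁ : xi (2 * k + 1 + 1) = 0 := by unfold xi; omega
      have h₂ : xi (2 * k + 1 + 1 + 1) = 1 := by unfold xi; omega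
      have h₃ : xi (2 * k + 1 + 2 + 1) = 0 := by unfold xi; omega
      have h₄ : (2 * k + 1) / 2 = k := by omega
      have h₅ : (2 * k + 1 + 1) / 2 = k + 1 := by omega
      have h₆ : (2 * k + 1 + 2) / 2 = k + 1 := by omega
      have h₇ : ¬ Even (2 * k + 1 + 2) := by grind
      rw [h₁, h₂, h₃, h₄, h₅, h₆, if_neg h₇]
      field_simp
      ring

theorem stmt1 (a b c w0 w1 : ℝ) (ha : 0 < a) (hb : 0 < b) (hc : 0 < c)
    (α β A B : ℝ)
    (hα : α = (a * b + Real.sqrt (a ^ 2 * b ^ 2 + 4 * a * b * c)) / 2)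
    (hβ : β = (a * b - Real.sqrt (a ^ 2 * b ^ 2 + 4 * a * b * c)) / 2)
    (hA : A = (w1 - (β / a) * w0) / (α - β))
    (hB : B = (w1 - (α / a) * w0) / (α - β))
    (n : ℕ) (hn : 1 ≤ n) :
    biper a b c w0 w1 n =
      a ^ xi (n + 1) / (a * b) ^ (n / 2) * (A * α ^ n - B * β ^ n) := by
  have hD : 0 < a ^ 2 * b ^ 2 + 4 * a * b * c := by positivity
  have hs := Real.sq_sqrt hD.le
  have hαβ : α - β ≠ 0 := by
    have hpos := Real.sqrt_pos.mpr hD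
    rw [hα, hβ]
    linarith
  have hα₂ : α ^ 2 = a * b * α + a * b * c := by rw [hα]; linear_combination hs / 4
  have hβ₂ : β ^ 2 = a * b * β + a * b * c := by rw [hβ]; linear_combination hs / 4
  have h := biper_eq_of_linear_recurrence (c := c) ha.ne' hb.ne'
    (u := fun n => A * α ^ n - B * β ^ n)
    (fun n => by linear_combination A * α ^ n * hα₂ - B * β ^ n * hβ₂) n
  have h₀ : a * (A * α ^ 0 - B * β ^ 0) = w0 := by
    rw [hA, hB]
    field_simp
    ring
  have h₁ : A * α ^ 1 - B * β ^ 1 = w1 := by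
    rw [hA, hB]
    field_simp
    ring
  simpa only [h₀, h₁] using h
end

section
/- Let a, b, c be positive real numbers, set α = (ab + √(a²b² + 4abc))/2 and β = (ab − √(a²b² + 4abc))/2, and let {u_n} be the bi-periodic Fibonacci sequence. Then for every integer n ≥ 0, u_n = (a^{ξ(n+1)} / (ab)^{⌊n/2⌋}) · (α^n − β^n)/(α − β). -/
theorem biper_even_odd_mul {a b c x y : ℝ} (hx : x ^ 2 = a * b * x + a * b * c)
    (hy : y ^ 2 = a * b * y + a * b * c) (m : ℕ) :
    biper a b c 0 1 (2 * m) * ((a * b) ^ m * (x - y)) = a * (x ^ (2 * m) - y ^ (2 * m)) ∧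
      biper a b c 0 1 (2 * m + 1) * ((a * b) ^ m * (x - y)) =
        x ^ (2 * m + 1) - y ^ (2 * m + 1) := by
  induction m with
  | zero => simp [biper]
  | succ k ih =>
    obtain ⟨he, ho⟩ := ih
    have even_step : biper a b c 0 1 (2 * k + 2) =
        a * biper a b c 0 1 (2 * k + 1) + c * biper a b c 0 1 (2 * k) := by
      have h : Even (2 * k + 2) := ⟨k + 1, by ring⟩
      rw [biper, if_pos h]
    have odd_step : biper a b c 0 1 (2 * k + 3) =
        b * biper a b c 0 1 (2 * k + 2) + c * biper a b c 0 1 (2 * k + 1) := by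
      have h : ¬ Even (2 * k + 1 + 2) := by
        rw [Nat.not_even_iff_odd]
        exact ⟨k + 1, by ring⟩
      rw [biper, if_neg h]
    have key : biper a b c 0 1 (2 * k + 2) * ((a * b) ^ (k + 1) * (x - y)) =
        a * (x ^ (2 * k + 2) - y ^ (2 * k + 2)) := by
      rw [even_step]
      linear_combination a * b * c * he + a * (a * b) * ho
        - a * x ^ (2 * k) * hx + a * y ^ (2 * k) * hy
    refine ⟨key, ?_⟩
    change biper a b c 0 1 (2 * k + 3) * _ = x ^ (2 * k + 3) - y ^ (2 * k + 3)
    rw [odd_step]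
    linear_combination b * key + a * b * c * ho
      - x ^ (2 * k + 1) * hx + y ^ (2 * k + 1) * hy

theorem stmt2 (a b c : ℝ) (ha : 0 < a) (hb : 0 < b) (hc : 0 < c)
    (α β : ℝ)
    (hα : α = (a * b + Real.sqrt (a ^ 2 * b ^ 2 + 4 * a * b * c)) / 2)
    (hβ : β = (a * b - Real.sqrt (a ^ 2 * b ^ 2 + 4 * a * b * c)) / 2)
    (n : ℕ) :
    biper a b c 0 1 n =
      a ^ xi (n + 1) / (a * b) ^ (n / 2) * ((α ^ n - β ^ n) / (α - β)) := by
  have hab : 0 < a * b := mul_pos ha hb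
  have hD : 0 < a ^ 2 * b ^ 2 + 4 * a * b * c := by positivity
  have hs := Real.sq_sqrt hD.le
  have hx : α ^ 2 = a * b * α + a * b * c := by
    rw [hα]
    linear_combination hs / 4
  have hy : β ^ 2 = a * b * β + a * b * c := by
    rw [hβ]
    linear_combination hs / 4
  have hne : α - β ≠ 0 := by
    have h : α - β = Real.sqrt (a ^ 2 * b ^ 2 + 4 * a * b * c) := by
      rw [hα, hβ]
      ring
    rw [h]
    exact (Real.sqrt_pos.mpr hD).ne'
  rw [div_mul_div_comm]
  rcases Nat.even_or_odd' n with ⟨m, rfl | rfl⟩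
  · rw [eq_div_iff (mul_ne_zero (pow_ne_zero _ hab.ne') hne),
      show xi (2 * m + 1) = 1 by unfold xi; omega, show 2 * m / 2 = m by omega, pow_one]
    exact (biper_even_odd_mul hx hy m).1
  · rw [eq_div_iff (mul_ne_zero (pow_ne_zero _ hab.ne') hne),
      show xi (2 * m + 1 + 1) = 0 by unfold xi; omega, show (2 * m + 1) / 2 = m by omega,
      pow_zero, one_mul]
    exact (biper_even_odd_mul hx hy m).2
end

section
/- Let a, b, c be positive real numbers, set α = (ab + √(a²b² + 4abc))/2 and β = (ab − √(a²b² + 4abc))/2, and let {v_n} be the bi-periodic Lucas sequence. Then for every integer n ≥ 0, v_n = (a^{−ξ(n)} / (ab)^{⌊n/2⌋}) · (α^n + β^n). -/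
theorem biper_even_add_two (a b c w0 w1 : ℝ) (k : ℕ) :
    biper a b c w0 w1 (2 * (k + 1)) =
      a * biper a b c w0 w1 (2 * k + 1) + c * biper a b c w0 w1 (2 * k) := by
  have h : Even (2 * k + 2) := ⟨k + 1, by ring⟩
  rw [show 2 * (k + 1) = 2 * k + 2 by ring, biper, if_pos h]

theorem biper_odd_add_two (a b c w0 w1 : ℝ) (k : ℕ) :
    biper a b c w0 w1 (2 * (k + 1) + 1) =
      b * biper a b c w0 w1 (2 * (k + 1)) + c * biper a b c w0 w1 (2 * k + 1) := by
  have h : ¬ Even (2 * k + 1 + 2) := by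
    rw [Nat.not_even_iff_odd]
    exact ⟨k + 1, by ring⟩
  rw [show 2 * (k + 1) + 1 = 2 * k + 1 + 2 by ring, biper, if_neg h]
  rfl

/-- Binet's formula with the denominators cleared, for even and odd indices simultaneously. -/
theorem biper_lucas_mul_pow {a b c α β : ℝ} (hsum : α + β = a * b)
    (hα : α ^ 2 = a * b * α + a * b * c) (hβ : β ^ 2 = a * b * β + a * b * c) (k : ℕ) :
    (a * b) ^ k * biper a b c 2 b (2 * k) = α ^ (2 * k) + β ^ (2 * k) ∧
      a * (a * b) ^ k * biper a b c 2 b (2 * k + 1) =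
        α ^ (2 * k + 1) + β ^ (2 * k + 1) := by
  induction k with
  | zero => simp [biper, hsum]; norm_num
  | succ k ih =>
    obtain ⟨h0, h1⟩ := ih
    have h2 : (a * b) ^ (k + 1) * biper a b c 2 b (2 * (k + 1)) =
        α ^ (2 * (k + 1)) + β ^ (2 * (k + 1)) := by
      rw [biper_even_add_two]
      linear_combination (a * b) * h1 + (a * b * c) * h0 - α ^ (2 * k) * hα - β ^ (2 * k) * hβ
    refine ⟨h2, ?_⟩
    rw [biper_odd_add_two]
    linear_combination (a * b) * h2 + (a * b * c) * h1 - α ^ (2 * k + 1) * hα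
      - β ^ (2 * k + 1) * hβ

theorem stmt3 (a b c : ℝ) (ha : 0 < a) (hb : 0 < b) (hc : 0 < c)
    (α β : ℝ)
    (hα : α = (a * b + Real.sqrt (a ^ 2 * b ^ 2 + 4 * a * b * c)) / 2)
    (hβ : β = (a * b - Real.sqrt (a ^ 2 * b ^ 2 + 4 * a * b * c)) / 2)
    (n : ℕ) :
    biper a b c 2 b n =
      a ^ (-(xi n : ℤ)) / (a * b) ^ (n / 2) * (α ^ n + β ^ n) := by
  have hsq := Real.sq_sqrt (show 0 ≤ a ^ 2 * b ^ 2 + 4 * a * b * c by positivity)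
  have hab : a * b ≠ 0 := by positivity
  have hsum : α + β = a * b := by rw [hα, hβ]; ring
  have hα' : α ^ 2 = a * b * α + a * b * c := by rw [hα]; linear_combination hsq / 4
  have hβ' : β ^ 2 = a * b * β + a * b * c := by rw [hβ]; linear_combination hsq / 4
  obtain ⟨k, rfl | rfl⟩ := Nat.even_or_odd' n
  · rw [← (biper_lucas_mul_pow hsum hα' hβ' k).1, xi, Nat.mul_mod_right,
      Nat.mul_div_cancel_left k two_pos]
    simp [← mul_assoc, inv_mul_cancel₀ (pow_ne_zero k hab)]
  · rw [← (biper_lucas_mul_pow hsum hα' hβ' k).2, xi, show (2 * k + 1) % 2 = 1 by omega,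
      show (2 * k + 1) / 2 = k by omega, Nat.cast_one, zpow_neg_one]
    field_simp
end

section
/- Let a, b, c be positive real numbers, and let {u_n} and {v_n} be the bi-periodic Fibonacci and bi-periodic Lucas sequences respectively. Then for every integer n ≥ 1, v_n = (b/a)^{ξ(n)} · (u_{n+1} + c·u_{n-1}). -/
theorem biper_two_mul_add_two (a b c w0 w1 : ℝ) (k : ℕ) :
    biper a b c w0 w1 (2 * k + 2) =
      a * biper a b c w0 w1 (2 * k + 1) + c * biper a b c w0 w1 (2 * k) := by
  rw [biper, if_pos (by grind)]

theorem biper_two_mul_add_three (a b c w0 w1 : ℝ) (k : ℕ) :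
    biper a b c w0 w1 (2 * k + 3) =
      b * biper a b c w0 w1 (2 * k + 2) + c * biper a b c w0 w1 (2 * k + 1) := by
  rw [biper, if_neg (by grind)]

/-- The bi-periodic Lucas numbers in terms of the bi-periodic Fibonacci numbers, at two
consecutive indices, with the denominator `a` cleared. -/
theorem biper_lucas_eq_fib (a b c : ℝ) (k : ℕ) :
    a * biper a b c 2 b (2 * k + 1) =
        b * (biper a b c 0 1 (2 * k + 2) + c * biper a b c 0 1 (2 * k)) ∧
      biper a b c 2 b (2 * k + 2) =
        biper a b c 0 1 (2 * k + 3) + c * biper a b c 0 1 (2 * k + 1) := by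
  induction k with
  | zero =>
    have h₁ := biper_two_mul_add_two a b c 0 1 0
    have h₂ := biper_two_mul_add_three a b c 0 1 0
    have h₃ := biper_two_mul_add_two a b c 2 b 0
    simp only [mul_zero, zero_add, biper.eq_1, biper.eq_2] at *
    constructor
    · rw [h₁]; ring
    · rw [h₂, h₃, h₁]; ring
  | succ k ih =>
    obtain ⟨h_odd, h_even⟩ := ih
    have u₂ := biper_two_mul_add_two a b c 0 1 k
    have u₃ := biper_two_mul_add_three a b c 0 1 k
    have u₄ := biper_two_mul_add_two a b c 0 1 (k + 1)
    have u₅ := biper_two_mul_add_three a b c 0 1 (k + 1)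
    have v₃ := biper_two_mul_add_three a b c 2 b k
    have v₄ := biper_two_mul_add_two a b c 2 b (k + 1)
    simp only [mul_add, mul_one, add_assoc, Nat.reduceAdd] at *
    have h : a * biper a b c 2 b (2 * k + 3) =
        b * biper a b c 0 1 (2 * k + 4) + b * (c * biper a b c 0 1 (2 * k + 2)) := by
      linear_combination a * v₃ + a * b * h_even + c * h_odd - b * u₄ - b * c * u₂
    refine ⟨h, ?_⟩
    linear_combination v₄ + h + c * h_even - u₅ - c * u₃

theorem stmt4 (a b c : ℝ) (ha : 0 < a) (hb : 0 < b) (hc : 0 < c)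
    (n : ℕ) (hn : 1 ≤ n) :
    biper a b c 2 b n =
      (b / a) ^ xi n * (biper a b c 0 1 (n + 1) + c * biper a b c 0 1 (n - 1)) := by
  obtain ⟨k, rfl | rfl⟩ : ∃ k, n = 2 * k + 1 ∨ n = 2 * k + 2 := ⟨(n - 1) / 2, by omega⟩
  · have hx : xi (2 * k + 1) = 1 := by unfold xi; omega
    have h := (biper_lucas_eq_fib a b c k).1
    rw [hx, pow_one, Nat.add_sub_cancel, div_mul_eq_mul_div, eq_div_iff ha.ne', mul_comm]
    exact h
  · have hx : xi (2 * k + 2) = 0 := by unfold xi; omega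
    rw [hx, pow_zero, one_mul]
    exact (biper_lucas_eq_fib a b c k).2
end

section
/- Let a, b, c be positive real numbers, and let {u_n} and {v_n} be the bi-periodic Fibonacci and bi-periodic Lucas sequences respectively. Then for every integer n ≥ 1, v_n = b·u_n + 2c·(b/a)^{ξ(n)}·u_{n-1}. -/
theorem biper_add_two (a b c w0 w1 : ℝ) (n : ℕ) :
    biper a b c w0 w1 (n + 2) =
      (if Even n then a else b) * biper a b c w0 w1 (n + 1) + c * biper a b c w0 w1 n := by
  simp [biper, Nat.even_add]

theorem xi_eq_ite (n : ℕ) : xi n = if Even n then 0 else 1 := by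
  unfold xi
  grind

theorem biper_lucas_succ (a b c : ℝ) (ha : a ≠ 0) (n : ℕ) :
    biper a b c 2 b (n + 1) =
      b * biper a b c 0 1 (n + 1) + 2 * c * (b / a) ^ xi (n + 1) * biper a b c 0 1 n := by
  induction n using Nat.twoStepInduction with
  | zero => simp [biper]
  | one =>
    simp [biper, xi]
    ring
  | more n ih0 ih1 =>
    rw [biper_add_two _ _ _ 2, biper_add_two _ _ _ 0 1 (n + 1), ih0, ih1, biper_add_two]
    by_cases h : Even n <;>
    · simp only [xi_eq_ite, Nat.even_add_one, h, not_true_eq_false, not_false_eq_true, if_true,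
        if_false]
      field_simp
      ring

theorem stmt5 (a b c : ℝ) (ha : 0 < a) (hb : 0 < b) (hc : 0 < c)
    (n : ℕ) (hn : 1 ≤ n) :
    biper a b c 2 b n =
      b * biper a b c 0 1 n + 2 * c * (b / a) ^ xi n * biper a b c 0 1 (n - 1) := by
  obtain ⟨m, rfl⟩ := Nat.exists_eq_add_of_le' hn
  exact biper_lucas_succ a b c ha.ne' m
end

section
/- Let a, b, c be positive real numbers, set α = (ab + √(a²b² + 4abc))/2 and β = (ab − √(a²b² + 4abc))/2, and let {u_n} be the bi-periodic Fibonacci sequence. Then for every integer m ≥ 1 and for z equal to either α or β, z^m = a^{⌈m/2⌉ − 1}·b^{⌊m/2⌋}·z·u_m + c·a^{⌊m/2⌋}·b^{⌈m/2⌉}·u_{m-1}. -/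
/-- Powers of a root of `x ^ 2 - a * b * x - a * b * c` in terms of the bi-periodic
Fibonacci sequence, for odd and even exponents simultaneously. -/
theorem biper_pow_odd_and_even {a b c z : ℝ} (hz : z ^ 2 = a * b * z + a * b * c) (k : ℕ) :
    z ^ (2 * k + 1) = a ^ k * b ^ k * z * biper a b c 0 1 (2 * k + 1)
        + c * a ^ k * b ^ (k + 1) * biper a b c 0 1 (2 * k) ∧
      z ^ (2 * k + 2) = a ^ k * b ^ (k + 1) * z * biper a b c 0 1 (2 * k + 2)
        + c * a ^ (k + 1) * b ^ (k + 1) * biper a b c 0 1 (2 * k + 1) := by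
  have even_of_odd (k : ℕ)
      (h : z ^ (2 * k + 1) = a ^ k * b ^ k * z * biper a b c 0 1 (2 * k + 1)
        + c * a ^ k * b ^ (k + 1) * biper a b c 0 1 (2 * k)) :
      z ^ (2 * k + 2) = a ^ k * b ^ (k + 1) * z * biper a b c 0 1 (2 * k + 2)
        + c * a ^ (k + 1) * b ^ (k + 1) * biper a b c 0 1 (2 * k + 1) := by
    have hu : biper a b c 0 1 (2 * k + 2)
        = a * biper a b c 0 1 (2 * k + 1) + c * biper a b c 0 1 (2 * k) := by
      rw [biper, if_pos (by simp [parity_simps])]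
    rw [hu, pow_succ z (2 * k + 1), h]
    linear_combination a ^ k * b ^ k * biper a b c 0 1 (2 * k + 1) * hz
  induction k with
  | zero => exact ⟨by simp [biper], even_of_odd 0 (by simp [biper])⟩
  | succ k ih =>
    have hodd : z ^ (2 * (k + 1) + 1)
        = a ^ (k + 1) * b ^ (k + 1) * z * biper a b c 0 1 (2 * (k + 1) + 1)
          + c * a ^ (k + 1) * b ^ (k + 1 + 1) * biper a b c 0 1 (2 * (k + 1)) := by
      have hu : biper a b c 0 1 (2 * k + 3)
          = b * biper a b c 0 1 (2 * k + 2) + c * biper a b c 0 1 (2 * k + 1) := by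
        rw [biper, if_neg (by simp [parity_simps])]
      rw [show 2 * (k + 1) + 1 = 2 * k + 3 by ring, show 2 * (k + 1) = 2 * k + 2 by ring, hu,
        pow_succ z (2 * k + 2), ih.2]
      linear_combination a ^ k * b ^ (k + 1) * biper a b c 0 1 (2 * k + 2) * hz
    exact ⟨hodd, even_of_odd (k + 1) hodd⟩

theorem stmt7 (a b c : ℝ) (ha : 0 < a) (hb : 0 < b) (hc : 0 < c)
    (α β : ℝ)
    (hα : α = (a * b + Real.sqrt (a ^ 2 * b ^ 2 + 4 * a * b * c)) / 2)
    (hβ : β = (a * b - Real.sqrt (a ^ 2 * b ^ 2 + 4 * a * b * c)) / 2)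
    (m : ℕ) (hm : 1 ≤ m) (z : ℝ) (hz : z = α ∨ z = β) :
    z ^ m = a ^ ((m + 1) / 2 - 1) * b ^ (m / 2) * z * biper a b c 0 1 m
      + c * a ^ (m / 2) * b ^ ((m + 1) / 2) * biper a b c 0 1 (m - 1) := by
  have hs : Real.sqrt (a ^ 2 * b ^ 2 + 4 * a * b * c) ^ 2 = a ^ 2 * b ^ 2 + 4 * a * b * c :=
    Real.sq_sqrt (by positivity)
  have hroot : z ^ 2 = a * b * z + a * b * c := by
    rcases hz with rfl | rfl
    · rw [hα]
      linear_combination hs / 4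
    · rw [hβ]
      linear_combination hs / 4
  obtain ⟨k, rfl | rfl⟩ : ∃ k, m = 2 * k + 1 ∨ m = 2 * k + 2 := ⟨(m - 1) / 2, by omega⟩
  · rw [show (2 * k + 1 + 1) / 2 = k + 1 by omega, show (2 * k + 1) / 2 = k by omega]
    exact (biper_pow_odd_and_even hroot k).1
  · rw [show (2 * k + 2 + 1) / 2 = k + 1 by omega, show (2 * k + 2) / 2 = k + 1 by omega]
    exact (biper_pow_odd_and_even hroot k).2
end

section
/- Let a, b, c be positive real numbers, let {w_n} be the bi-periodic Horadam sequence with initial values w_0, w_1, and let {u_n} be the bi-periodic Fibonacci sequence. Then for all integers n ≥ 0, r ≥ 0 and m ≥ 2, w_{mn+r} = Σ_{i=0}^{n} C(n,i) · (b/a)^{(ξ(mn+r) − 2i·ξ(m) + i − ξ(i+r) + n·ξ(m))/2} · c^{n−i} · u_m^i · u_{m-1}^{n−i} · w_{i+r}, where the exponent (ξ(mn+r) − 2i·ξ(m) + i − ξ(i+r) + n·ξ(m))/2 is always a nonnegative integer. -/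
/-- Twice the exponent of `b/a` appearing in Theorem 2:
`ξ(mn+r) − 2i·ξ(m) + i − ξ(i+r) + n·ξ(m)` (an integer). -/
def expNum (m n r i : ℕ) : ℤ :=
  (xi (m * n + r) : ℤ) - 2 * i * (xi m) + i - (xi (i + r)) + n * (xi m)

/-- A sequence satisfying `f (k + m) = x f (k + 1) + y f k` expands binomially along steps
of length `m`. -/
theorem binomial_expansion_of_step {R : Type*} [CommSemiring R] (f : ℕ → R) (x y : R) (m : ℕ)
    (hf : ∀ k, f (k + m) = x * f (k + 1) + y * f k) (n r : ℕ) :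
    f (m * n + r) =
      ∑ i ∈ Finset.range (n + 1), (n.choose i : R) * (x ^ i * y ^ (n - i) * f (i + r)) := by
  induction n generalizing r with
  | zero => simp
  | succ n ih =>
    rw [Finset.sum_choose_succ_mul (fun i j => x ^ i * y ^ j * f (i + r)),
      show m * (n + 1) + r = m * n + r + m by ring, hf, add_assoc, ih, ih, Finset.mul_sum,
      Finset.mul_sum, add_comm]
    congr 1
    · refine Finset.sum_congr rfl fun i hi => ?_
      rw [Nat.sub_add_comm (Finset.mem_range_succ_iff.mp hi)]
      ring
    · refine Finset.sum_congr rfl fun i _ => ?_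
      rw [show i + (r + 1) = i + 1 + r by ring]
      ring

/-- The addition formula for solutions of a second-order linear recurrence. -/
theorem recurrence_add {R : Type*} [CommRing R] (f g : ℕ → R) (p c : R)
    (hf : ∀ k, f (k + 2) = p * f (k + 1) + c * f k)
    (hg : ∀ k, g (k + 2) = p * g (k + 1) + c * g k) (hg0 : g 0 = 0) (hg1 : g 1 = 1)
    (m k : ℕ) : f (k + (m + 1)) = g (m + 1) * f (k + 1) + c * g m * f k := by
  induction m generalizing k with
  | zero => simp [hg0, hg1]
  | succ m ih =>
    rw [show k + (m + 1 + 1) = k + 1 + (m + 1) by ring, ih, hf, hg]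
    ring

/-- Rescaling the odd terms turns the bi-periodic recurrence into one with constant
coefficients. -/
theorem biper_div_recurrence (a b c w0 w1 s : ℝ) (hs : s ≠ 0) (hab : a * s ^ 2 = b) (k : ℕ) :
    biper a b c w0 w1 (k + 2) / s ^ xi (k + 2) =
      a * s * (biper a b c w0 w1 (k + 1) / s ^ xi (k + 1)) +
        c * (biper a b c w0 w1 k / s ^ xi k) := by
  subst hab
  rw [biper]
  rcases Nat.even_or_odd k with h | h
  · have h0 : k % 2 = 0 := Nat.even_iff.mp h
    have h1 : (k + 1) % 2 = 1 := by omega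
    have h2 : Even (k + 2) := by rw [Nat.even_iff]; omega
    simp only [xi, Nat.add_mod_right, h0, h1, h2, if_true]
    field_simp
  · have h0 : k % 2 = 1 := Nat.odd_iff.mp h
    have h1 : (k + 1) % 2 = 0 := by omega
    have h2 : ¬ Even (k + 2) := by rw [Nat.even_iff]; omega
    simp only [xi, Nat.add_mod_right, h0, h1, h2, if_false]
    field_simp

theorem two_dvd_expNum (m n r i : ℕ) : 2 ∣ expNum m n r i := by
  unfold expNum xi
  rcases Nat.mod_two_eq_zero_or_one m with h | h
  · have : (m * n + r) % 2 = r % 2 := by simp [Nat.add_mod, Nat.mul_mod, h]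
    rw [this, h]
    push_cast
    omega
  · have : (m * n + r) % 2 = (n + r) % 2 := by simp [Nat.add_mod, Nat.mul_mod, h]
    rw [this, h]
    push_cast
    omega

theorem expNum_nonneg {n i : ℕ} (m r : ℕ) (hi : i ≤ n) : 0 ≤ expNum m n r i := by
  unfold expNum xi
  rcases Nat.mod_two_eq_zero_or_one m with h | h
  · have : (m * n + r) % 2 = r % 2 := by simp [Nat.add_mod, Nat.mul_mod, h]
    rw [this, h]
    push_cast
    omega
  · have : (m * n + r) % 2 = (n + r) % 2 := by simp [Nat.add_mod, Nat.mul_mod, h]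
    rw [this, h]
    push_cast
    omega

theorem sq_zpow_expNum_half {n i : ℕ} (s : ℝ) (hs : s ≠ 0) (m r : ℕ) (hi : i ≤ n) :
    (s ^ 2) ^ (expNum m n r i / 2) =
      s ^ xi (m * n + r) * (s / s ^ xi m) ^ i * (s ^ xi m) ^ (n - i) / s ^ xi (i + r) := by
  rw [← zpow_natCast s 2, ← zpow_mul, Nat.cast_ofNat, Int.mul_ediv_cancel' (two_dvd_expNum m n r i),
    eq_div_iff (pow_ne_zero _ hs), div_pow, mul_div_assoc', div_mul_eq_mul_div,
    eq_div_iff (pow_ne_zero _ (pow_ne_zero _ hs))]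
  simp only [← zpow_natCast, ← zpow_mul, ← zpow_add₀ hs]
  congr 1
  unfold expNum
  push_cast [Nat.cast_sub hi]
  ring

theorem stmt8 (a b c w0 w1 : ℝ) (ha : 0 < a) (hb : 0 < b) (hc : 0 < c)
    (n r m : ℕ) (hm : 2 ≤ m) :
    (∀ i ≤ n, 2 ∣ expNum m n r i ∧ 0 ≤ expNum m n r i / 2) ∧
    biper a b c w0 w1 (m * n + r) =
      ∑ i ∈ Finset.range (n + 1),
        (n.choose i : ℝ) * (b / a) ^ (expNum m n r i / 2)
          * c ^ (n - i) * (biper a b c 0 1 m) ^ i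
          * (biper a b c 0 1 (m - 1)) ^ (n - i)
          * biper a b c w0 w1 (i + r) := by
  refine ⟨fun i hi => ⟨two_dvd_expNum m n r i, Int.ediv_nonneg (expNum_nonneg m r hi) zero_le_two⟩,
    ?_⟩
  obtain ⟨k, rfl⟩ : ∃ k, m = k + 1 := ⟨m - 1, by omega⟩
  obtain ⟨s, hs, hsq⟩ : ∃ s : ℝ, s ≠ 0 ∧ s ^ 2 = b / a :=
    ⟨√(b / a), (Real.sqrt_pos.mpr (div_pos hb ha)).ne', Real.sq_sqrt (div_pos hb ha).le⟩
  have hab : a * s ^ 2 = b := by rw [hsq, mul_div_cancel₀ _ ha.ne']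
  let f : ℕ → ℝ := fun j => biper a b c w0 w1 j / s ^ xi j
  let g : ℕ → ℝ := fun j => s * (biper a b c 0 1 j / s ^ xi j)
  have hg (j : ℕ) : g (j + 2) = a * s * g (j + 1) + c * g j := by
    simp only [g, biper_div_recurrence a b c 0 1 s hs hab j]
    ring
  have hstep := recurrence_add f g (a * s) c (biper_div_recurrence a b c w0 w1 s hs hab) hg
    (by simp [g, biper]) (by simp [g, biper, xi, hs]) k
  have hgk : g k = s ^ xi (k + 1) * biper a b c 0 1 k := by
    rcases Nat.mod_two_eq_zero_or_one k with h | h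
    · have h1 : (k + 1) % 2 = 1 := by omega
      simp [g, xi, h, h1]
    · have h1 : (k + 1) % 2 = 0 := by omega
      simp [g, xi, h, h1]
      field_simp
  have key := binomial_expansion_of_step f _ _ (k + 1) hstep n r
  rw [div_eq_iff (pow_ne_zero _ hs)] at key
  rw [key, Finset.sum_mul]
  refine Finset.sum_congr rfl fun i hi => ?_
  rw [← hsq, sq_zpow_expNum_half s hs _ r (Finset.mem_range_succ_iff.mp hi), hgk,
    Nat.add_sub_cancel]
  simp only [f, g, mul_pow, div_pow]
  ring
end

section
/- Let a, b, c be positive integers and let {w_n} be the integer bi-periodic Horadam sequence with integer initial values w_0, w_1, and {u_n} the bi-periodic Fibonacci sequence. For all integers m, n, r > 0, set E = ξ(m)·(n + ξ(n))/2 − ξ(mn)·ξ(r) (a nonnegative integer with E ≤ n). Then u_m divides a^n·w_{mn+r} − a^{n−E}·b^E·c^n·u_{m-1}^n·w_r. (This is the denominator-cleared form of the congruence w_{mn+r} ≡ (b/a)^E·c^n·u_{m-1}^n·w_r (mod u_m).) -/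
/-- The integer bi-periodic Horadam sequence with parameters `a, b, c` and
initial values `w0, w1`; the bi-periodic Fibonacci sequence is the
special case with initial values `0, 1`. -/
def biperZ (a b c w0 w1 : ℤ) : ℕ → ℤ
  | 0 => w0
  | 1 => w1
  | n + 2 => (if Even (n + 2) then a else b) * biperZ a b c w0 w1 (n + 1)
      + c * biperZ a b c w0 w1 n

theorem biperZ_add_two (a b c w0 w1 : ℤ) (n : ℕ) :
    biperZ a b c w0 w1 (n + 2) = (if Even n then a else b) * biperZ a b c w0 w1 (n + 1)
      + c * biperZ a b c w0 w1 n := by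
  simp [biperZ, Nat.even_add]

/-- Interchanging `a` and `b` fixes the odd terms of the bi-periodic Fibonacci sequence and
rescales the even ones. -/
theorem biperZ_swap (a b c : ℤ) (k : ℕ) :
    a * biperZ b a c 0 1 (2 * k) = b * biperZ a b c 0 1 (2 * k) ∧
      biperZ b a c 0 1 (2 * k + 1) = biperZ a b c 0 1 (2 * k + 1) := by
  induction k with
  | zero => simp [biperZ]
  | succ k ih =>
    obtain ⟨h0, h1⟩ := ih
    have even_step : a * biperZ b a c 0 1 (2 * k + 2) = b * biperZ a b c 0 1 (2 * k + 2) := by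
      rw [biperZ_add_two, biperZ_add_two, h1]
      simp only [even_two_mul, if_true]
      linear_combination c * h0
    refine ⟨even_step, ?_⟩
    have hodd : ¬ Even (2 * k + 1) := by simp
    change biperZ b a c 0 1 (2 * k + 1 + 2) = biperZ a b c 0 1 (2 * k + 1 + 2)
    rw [biperZ_add_two b a c 0 1 (2 * k + 1), biperZ_add_two a b c 0 1 (2 * k + 1), if_neg hodd,
      if_neg hodd]
    linear_combination even_step + c * h1

theorem biperZ_add_of_even (a b c w0 w1 : ℤ) {r : ℕ} (hr : Even r) (m : ℕ) :
    biperZ a b c w0 w1 (r + m + 1) = biperZ a b c 0 1 (m + 1) * biperZ a b c w0 w1 (r + 1)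
      + c * biperZ b a c 0 1 m * biperZ a b c w0 w1 r := by
  induction m using Nat.twoStepInduction with
  | zero => simp [biperZ]
  | one =>
    change biperZ a b c w0 w1 (r + 2) = _
    rw [biperZ_add_two]
    simp [biperZ, hr]
  | more m h0 h1 =>
    change biperZ a b c w0 w1 ((r + m + 1) + 2) = biperZ a b c 0 1 ((m + 1) + 2) * _ + _
    rw [biperZ_add_two a b c w0 w1 (r + m + 1), biperZ_add_two a b c 0 1 (m + 1),
      biperZ_add_two b a c 0 1 m]
    change _ * biperZ a b c w0 w1 (r + (m + 1) + 1) + _ = _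
    rw [h0, h1]
    by_cases hm : Even m <;> simp [hm, hr, Nat.even_add] <;> ring

theorem biperZ_add_of_odd (a b c w0 w1 : ℤ) {r : ℕ} (hr : ¬ Even r) (m : ℕ) :
    biperZ a b c w0 w1 (r + m + 1) = biperZ b a c 0 1 (m + 1) * biperZ a b c w0 w1 (r + 1)
      + c * biperZ a b c 0 1 m * biperZ a b c w0 w1 r := by
  induction m using Nat.twoStepInduction with
  | zero => simp [biperZ]
  | one =>
    change biperZ a b c w0 w1 (r + 2) = _
    rw [biperZ_add_two]
    simp [biperZ, hr]
  | more m h0 h1 =>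
    change biperZ a b c w0 w1 ((r + m + 1) + 2) = biperZ b a c 0 1 ((m + 1) + 2) * _ + _
    rw [biperZ_add_two a b c w0 w1 (r + m + 1), biperZ_add_two b a c 0 1 (m + 1),
      biperZ_add_two a b c 0 1 m]
    change _ * biperZ a b c w0 w1 (r + (m + 1) + 1) + _ = _
    rw [h0, h1]
    by_cases hm : Even m <;> simp [hm, hr, Nat.even_add] <;> ring

theorem biperZ_dvd_shift (a b c w0 w1 : ℤ) {m : ℕ} (hm : 0 < m) (r : ℕ) :
    biperZ a b c 0 1 m ∣ a * biperZ a b c w0 w1 (r + m)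
      - (if Odd m ∧ Even r then b else a) * c * biperZ a b c 0 1 (m - 1)
        * biperZ a b c w0 w1 r := by
  obtain ⟨k, rfl⟩ := Nat.exists_eq_add_one.mpr hm
  rw [Nat.add_sub_cancel, ← add_assoc]
  rcases Nat.even_or_odd' k with ⟨j, rfl | rfl⟩
  · obtain ⟨h0, h1⟩ := biperZ_swap a b c j
    by_cases hr : Even r
    · refine ⟨a * biperZ a b c w0 w1 (r + 1), ?_⟩
      rw [biperZ_add_of_even a b c w0 w1 hr, if_pos ⟨odd_two_mul_add_one j, hr⟩]
      linear_combination c * biperZ a b c w0 w1 r * h0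
    · refine ⟨a * biperZ a b c w0 w1 (r + 1), ?_⟩
      rw [biperZ_add_of_odd a b c w0 w1 hr, if_neg (fun h => hr h.2)]
      linear_combination a * biperZ a b c w0 w1 (r + 1) * h1
  · have h1 := (biperZ_swap a b c j).2
    have h2 : a * biperZ b a c 0 1 (2 * j + 1 + 1) = b * biperZ a b c 0 1 (2 * j + 1 + 1) :=
      (biperZ_swap a b c (j + 1)).1
    rw [if_neg (fun h => by grind)]
    by_cases hr : Even r
    · refine ⟨a * biperZ a b c w0 w1 (r + 1), ?_⟩
      rw [biperZ_add_of_even a b c w0 w1 hr]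
      linear_combination a * c * biperZ a b c w0 w1 r * h1
    · refine ⟨b * biperZ a b c w0 w1 (r + 1), ?_⟩
      rw [biperZ_add_of_odd a b c w0 w1 hr]
      linear_combination biperZ a b c w0 w1 (r + 1) * h2

/-- The exponent of `b / a` in the congruence for `w_{mn+r}` modulo `u_m`. -/
def biperExponent (m n r : ℕ) : ℕ := xi m * ((n + xi n) / 2) - xi (m * n) * xi r

theorem xi_mul_xi_le (m n r : ℕ) : xi (m * n) * xi r ≤ xi m * ((n + xi n) / 2) := by
  simp only [xi, Nat.mul_mod m n]
  rcases Nat.mod_two_eq_zero_or_one m with h | h <;>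
    rcases Nat.mod_two_eq_zero_or_one n with h' | h' <;>
    rcases Nat.mod_two_eq_zero_or_one r with h'' | h'' <;> simp [h, h', h''] <;> omega

theorem biperExponent_le (m n r : ℕ) : biperExponent m n r ≤ n := by
  simp only [biperExponent, xi, Nat.mul_mod m n]
  rcases Nat.mod_two_eq_zero_or_one m with h | h <;>
    rcases Nat.mod_two_eq_zero_or_one n with h' | h' <;>
    rcases Nat.mod_two_eq_zero_or_one r with h'' | h'' <;> simp [h, h', h''] <;> omega

theorem biperExponent_succ (m n r : ℕ) :
    biperExponent m (n + 1) r
      = biperExponent m n r + if Odd m ∧ Even (m * n + r) then 1 else 0 := by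
  simp only [biperExponent, xi, Nat.mul_mod m, Nat.odd_iff, Nat.even_iff, Nat.add_mod (m * n) r,
    Nat.add_mod n 1]
  rcases Nat.mod_two_eq_zero_or_one m with h | h <;>
    rcases Nat.mod_two_eq_zero_or_one n with h' | h' <;>
    rcases Nat.mod_two_eq_zero_or_one r with h'' | h'' <;> simp [h, h', h''] <;> omega

theorem biperZ_dvd_mul_add (a b c w0 w1 : ℤ) {m : ℕ} (hm : 0 < m) (n r : ℕ) :
    biperZ a b c 0 1 m ∣ a ^ n * biperZ a b c w0 w1 (m * n + r)
      - a ^ (n - biperExponent m n r) * b ^ biperExponent m n r * c ^ n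
        * biperZ a b c 0 1 (m - 1) ^ n * biperZ a b c w0 w1 r := by
  induction n with
  | zero => simp [biperExponent, xi]
  | succ n ih =>
    have step := biperZ_dvd_shift a b c w0 w1 hm (m * n + r)
    have hle := biperExponent_le m n r
    have hcoeff : a ^ (n + 1 - biperExponent m (n + 1) r) * b ^ biperExponent m (n + 1) r
        = (if Odd m ∧ Even (m * n + r) then b else a)
          * (a ^ (n - biperExponent m n r) * b ^ biperExponent m n r) := by
      rw [biperExponent_succ]
      split_ifs
      · rw [Nat.add_sub_add_right]
        ring
      · rw [add_zero, Nat.sub_add_comm hle]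
        ring
    rw [hcoeff, show m * (n + 1) + r = m * n + r + m by ring]
    obtain ⟨x, hx⟩ := step
    obtain ⟨y, hy⟩ := ih
    set d := if Odd m ∧ Even (m * n + r) then b else a
    refine ⟨a ^ n * x + d * c * biperZ a b c 0 1 (m - 1) * y, ?_⟩
    linear_combination a ^ n * hx + d * c * biperZ a b c 0 1 (m - 1) * hy

theorem stmt9 (a b c w0 w1 : ℤ) (ha : 0 < a) (hb : 0 < b) (hc : 0 < c)
    (m n r : ℕ) (hm : 0 < m) (hn : 0 < n) (hr : 0 < r) :
    -- E = ξ(m)·(n + ξ(n))/2 − ξ(mn)·ξ(r) is a nonnegative integer with E ≤ n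
    xi (m * n) * xi r ≤ xi m * ((n + xi n) / 2) ∧
    xi m * ((n + xi n) / 2) - xi (m * n) * xi r ≤ n ∧
    biperZ a b c 0 1 m ∣
      a ^ n * biperZ a b c w0 w1 (m * n + r)
        - a ^ (n - (xi m * ((n + xi n) / 2) - xi (m * n) * xi r))
          * b ^ (xi m * ((n + xi n) / 2) - xi (m * n) * xi r)
          * c ^ n * (biperZ a b c 0 1 (m - 1)) ^ n * biperZ a b c w0 w1 r := by
  exact ⟨xi_mul_xi_le m n r, biperExponent_le m n r, biperZ_dvd_mul_add a b c w0 w1 hm n r⟩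
end

section
/- Let a, b, c be positive real numbers, let {w_n} be the bi-periodic Horadam sequence with initial values w_0, w_1, and let {v_n} be the bi-periodic Lucas sequence. Then for all integers n ≥ 0 and k ≥ 1, w_{n+2k} = (a/b)^{ξ(n+1)·ξ(k)} · v_k · w_{n+k} − (−c)^k · w_n. -/
/-- The index-doubling identity, valid for every `k` as soon as `b ≠ 0`. -/
theorem biper_add_two_mul (a b c w0 w1 : ℝ) (hb : b ≠ 0) (k : ℕ) : ∀ n : ℕ,
    biper a b c w0 w1 (n + 2 * k) =
      (a / b) ^ (xi (n + 1) * xi k) * biper a b c 2 b k * biper a b c w0 w1 (n + k)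
        - (-c) ^ k * biper a b c w0 w1 n := by
  induction k using Nat.twoStepInduction with
  | zero =>
    intro n
    simp [xi, biper]
    ring
  | one =>
    intro n
    rw [mul_one, biper_add_two]
    rcases Nat.mod_two_eq_zero_or_one n with h | h
    · simp [xi, biper, Nat.add_mod, Nat.even_iff, h, hb]
    · simp [xi, biper, Nat.add_mod, Nat.even_iff, h]
  | more k ih₀ ih₁ =>
    intro n
    have h₀ := ih₀ (n + 2)
    have h₁ := ih₁ (n + 1)
    have hw := biper_add_two a b c w0 w1 (n + 2 + 2 * k)
    have hn := biper_add_two a b c w0 w1 n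
    have hv := biper_add_two a b c 2 b k
    rw [show n + 1 + 2 * (k + 1) = n + 2 + 2 * k + 1 by ring,
      show n + 1 + (k + 1) = n + 2 + k by ring] at h₁
    rw [show n + 2 * (k + 2) = n + 2 + 2 * k + 2 by ring,
      show n + (k + 2) = n + 2 + k by ring, hw, h₀, h₁, hn, hv,
      pow_add (-c) k 1, pow_add (-c) k 2]
    generalize (-c) ^ k = q
    rcases Nat.mod_two_eq_zero_or_one n with h | h <;>
      rcases Nat.mod_two_eq_zero_or_one k with h' | h' <;>
      simp [xi, Nat.add_mod, Nat.even_iff, h, h'] <;> field_simp <;> ring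

theorem stmt10 (a b c w0 w1 : ℝ) (ha : 0 < a) (hb : 0 < b) (hc : 0 < c)
    (n k : ℕ) (hk : 1 ≤ k) :
    biper a b c w0 w1 (n + 2 * k) =
      (a / b) ^ (xi (n + 1) * xi k) * biper a b c 2 b k * biper a b c w0 w1 (n + k)
        - (-c) ^ k * biper a b c w0 w1 n :=
  biper_add_two_mul a b c w0 w1 hb.ne' k n
end

section
/- Let a, b, c be positive real numbers, let {w_n} be the bi-periodic Horadam sequence with initial values w_0, w_1, and let {v_n} be the bi-periodic Lucas sequence. Then for all integers n ≥ 0, r ≥ 0 and m ≥ 2, w_{2mn+r} = Σ_{i=0}^{n} C(n,i) · (−1)^{(m+1)(n−i)} · (a/b)^{ξ(m)·(i + ξ(i))/2 − ξ(im)·ξ(r)} · c^{m(n−i)} · v_m^i · w_{im+r}, where the exponent ξ(m)·(i + ξ(i))/2 − ξ(im)·ξ(r) is always a nonnegative integer. -/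
/-- The exponent `ξ(m)·(i + ξ(i))/2 − ξ(im)·ξ(r)` of `a/b` in Theorem 3. -/
def expE (m r i : ℕ) : ℤ :=
  (xi m : ℤ) * ((i + xi i) / 2) - (xi (i * m) : ℤ) * (xi r)

/-- Multiplication of a Horadam sequence by a Lucas number, for a recurrence with constant
coefficients. -/
lemma lucas_mul_horadam {R : Type*} [CommRing R] {p c : R} {V W : ℕ → R}
    (hV0 : V 0 = 2) (hV1 : V 1 = p) (hV : ∀ n, V (n + 2) = p * V (n + 1) + c * V n)
    (hW : ∀ n, W (n + 2) = p * W (n + 1) + c * W n) (m k : ℕ) :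
    V m * W (m + k) = W (2 * m + k) + (-c) ^ m * W k := by
  induction m using Nat.twoStepInduction generalizing k with
  | zero => simp [hV0, two_mul]
  | one =>
    have h := hW k
    rw [show 2 * 1 + k = k + 2 by ring, show 1 + k = k + 1 by ring, hV1]
    linear_combination -h
  | more m ih0 ih1 =>
    have h0 := ih0 (k + 2)
    have h1 := ih1 (k + 1)
    have h2 := hW (2 * m + k + 2)
    have h3 := hW k
    rw [show m + (k + 2) = m + 2 + k by ring, show 2 * m + (k + 2) = 2 * m + k + 2 by ring] at h0
    rw [show m + 1 + (k + 1) = m + 2 + k by ring,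
      show 2 * (m + 1) + (k + 1) = 2 * m + k + 2 + 1 by ring] at h1
    rw [show 2 * (m + 2) + k = 2 * m + k + 2 + 2 by ring, hV]
    linear_combination p * h1 + c * h0 - h2 + c * (-c) ^ m * h3

/-- Iterating a second-order linear recurrence `n` times. -/
lemma horadam_two_mul_add {R : Type*} [CommRing R] {v d : R} {X : ℕ → R}
    (hX : ∀ j, X (j + 2) = v * X (j + 1) + d * X j) (n j : ℕ) :
    X (2 * n + j) =
      ∑ i ∈ Finset.range (n + 1), (n.choose i : R) * (v ^ i * d ^ (n - i) * X (i + j)) := by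
  induction n generalizing j with
  | zero => simp
  | succ n ih =>
    rw [Finset.sum_choose_succ_mul (fun i k => v ^ i * d ^ k * X (i + j)),
      show 2 * (n + 1) + j = 2 * n + j + 2 by ring, hX,
      show 2 * n + j + 1 = 2 * n + (j + 1) by ring, ih, ih, Finset.mul_sum, Finset.mul_sum,
      add_comm]
    congr 1 <;> refine Finset.sum_congr rfl fun i hi => ?_
    · rw [Nat.sub_add_comm (Nat.lt_succ_iff.mp (Finset.mem_range.mp hi))]
      ring
    · rw [show i + 1 + j = i + (j + 1) by ring]
      ring

/-- Rescaling the odd terms turns a bi-periodic sequence into one with constant coefficients. -/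
lemma biper_rescale {a b s : ℝ} (hs : s ^ 2 * b = a) (c w0 w1 : ℝ) (n : ℕ) :
    s ^ xi (n + 2) * biper a b c w0 w1 (n + 2) =
      s * b * (s ^ xi (n + 1) * biper a b c w0 w1 (n + 1)) +
        c * (s ^ xi n * biper a b c w0 w1 n) := by
  rw [biper]
  rcases Nat.even_or_odd n with h | h
  · have h2 : Even (n + 2) := by grind
    have e0 : xi n = 0 := by grind [xi]
    have e1 : xi (n + 1) = 1 := by grind [xi]
    have e2 : xi (n + 2) = 0 := by grind [xi]
    rw [if_pos h2, e0, e1, e2]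
    linear_combination -biper a b c w0 w1 (n + 1) * hs
  · have h2 : ¬ Even (n + 2) := by grind
    have e0 : xi n = 1 := by grind [xi]
    have e1 : xi (n + 1) = 0 := by grind [xi]
    have e2 : xi (n + 2) = 1 := by grind [xi]
    rw [if_neg h2, e0, e1, e2]
    ring

lemma expE_nonneg (m r i : ℕ) : 0 ≤ expE m r i := by
  unfold expE xi
  rw [Nat.mul_mod]
  rcases Nat.mod_two_eq_zero_or_one m with hm | hm <;>
  rcases Nat.mod_two_eq_zero_or_one i with hi | hi <;>
  rcases Nat.mod_two_eq_zero_or_one r with hr | hr <;>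
  simp only [hm, hi, hr] <;> norm_num <;> omega

lemma two_mul_expE_add (m r i : ℕ) :
    2 * expE m r i + xi r = xi m * i + xi (i * m + r) := by
  unfold expE xi
  rw [Nat.add_mod, Nat.mul_mod]
  rcases Nat.mod_two_eq_zero_or_one m with hm | hm <;>
  rcases Nat.mod_two_eq_zero_or_one i with hi | hi <;>
  rcases Nat.mod_two_eq_zero_or_one r with hr | hr <;>
  simp only [hm, hi, hr] <;> norm_num <;> omega

theorem stmt11 (a b c w0 w1 : ℝ) (ha : 0 < a) (hb : 0 < b) (hc : 0 < c)
    (n r m : ℕ) (hm : 2 ≤ m) :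
    (∀ i ≤ n, 0 ≤ expE m r i) ∧
    biper a b c w0 w1 (2 * m * n + r) =
      ∑ i ∈ Finset.range (n + 1),
        (n.choose i : ℝ) * (-1 : ℝ) ^ ((m + 1) * (n - i))
          * (a / b) ^ (expE m r i) * c ^ (m * (n - i))
          * (biper a b c 2 b m) ^ i * biper a b c w0 w1 (i * m + r) := by
  refine ⟨fun i _ => expE_nonneg m r i, ?_⟩
  obtain ⟨s, hs0, hs⟩ : ∃ s : ℝ, 0 < s ∧ s ^ 2 = a / b :=
    ⟨√(a / b), by positivity, Real.sq_sqrt (by positivity)⟩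
  have hsb : s ^ 2 * b = a := by rw [hs]; field_simp
  let V : ℕ → ℝ := fun k => s ^ xi k * biper a b c 2 b k
  let W : ℕ → ℝ := fun k => s ^ xi k * biper a b c w0 w1 k
  have hmul := lucas_mul_horadam (V := V) (W := W) (p := s * b) (c := c)
    (by simp [V, xi, biper]) (by simp [V, xi, biper])
    (biper_rescale hsb c 2 b) (biper_rescale hsb c w0 w1) m
  have key := horadam_two_mul_add (X := fun j => W (j * m + r)) (v := V m)
    (d := (-1) ^ (m + 1) * c ^ m) (fun j => by
      have h := hmul (j * m + r)
      rw [show m + (j * m + r) = (j + 1) * m + r by ring,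
        show 2 * m + (j * m + r) = (j + 2) * m + r by ring, neg_pow] at h
      linear_combination -h) n 0
  have hr : xi (2 * m * n + r) = xi r := by simp [xi, Nat.add_mod, mul_assoc]
  have hpos : s ^ xi r ≠ 0 := by positivity
  apply mul_left_cancel₀ hpos
  calc s ^ xi r * biper a b c w0 w1 (2 * m * n + r)
      = W ((2 * n + 0) * m + r) := by
        rw [show (2 * n + 0) * m + r = 2 * m * n + r by ring, ← hr]
    _ = _ := by
      rw [key, Finset.mul_sum]
      refine Finset.sum_congr rfl fun i _ => ?_
      have hscale : s ^ xi r * (a / b) ^ expE m r i = (s ^ xi m) ^ i * s ^ xi (i * m + r) := by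
        rw [← hs, ← pow_mul, ← zpow_natCast s 2, ← zpow_mul, ← zpow_natCast s (xi r),
          ← zpow_natCast s (xi m * i), ← zpow_natCast s (xi (i * m + r)),
          ← zpow_add₀ hs0.ne', ← zpow_add₀ hs0.ne']
        congr 1
        push_cast
        linarith [two_mul_expE_add m r i]
      simp only [V, W, add_zero, mul_pow, ← pow_mul]
      rw [← pow_mul] at hscale
      linear_combination -(n.choose i : ℝ) * (-1 : ℝ) ^ ((m + 1) * (n - i)) * c ^ (m * (n - i))
        * biper a b c 2 b m ^ i * biper a b c w0 w1 (i * m + r) * hscale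
end

section
/- Let a, b, c be positive integers and let {w_n} be the integer bi-periodic Horadam sequence with integer initial values w_0, w_1, and {v_n} the bi-periodic Lucas sequence. Then for all integers m, n, r > 0, v_m divides b^n·(w_{2mn+r} − (−1)^{(m+1)n}·c^{mn}·w_r). (This is the denominator-cleared form of the congruence w_{2mn+r} ≡ (−1)^{(m+1)n}·c^{mn}·w_r (mod v_m).) -/
theorem biperZ_lucas_mul (a b c w0 w1 : ℤ) (m s : ℕ) :
    b * (biperZ a b c w0 w1 (s + 2 * m) + (-c) ^ m * biperZ a b c w0 w1 s) =
      (if Even m then b else if Even s then a else b) *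
        (biperZ a b c 2 b m * biperZ a b c w0 w1 (s + m)) := by
  induction m using Nat.twoStepInduction generalizing s with
  | zero =>
    simp only [biperZ, Even.zero, if_true, mul_zero, add_zero, pow_zero]
    ring
  | one =>
    rw [show s + 2 * 1 = s + 2 from rfl, biperZ_add_two]
    simp only [biperZ, Nat.not_even_one, if_false]
    ring
  | more m ih0 ih1 =>
    have h0 := ih0 (s + 2)
    have h1 := ih1 (s + 1)
    rw [show s + 2 + 2 * m = s + 2 * m + 2 by ring, show s + 2 + m = s + (m + 2) by ring,
      biperZ_add_two a b c w0 w1 s] at h0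
    rw [show s + 1 + 2 * (m + 1) = s + 2 * m + 3 by ring,
      show s + 1 + (m + 1) = s + (m + 2) by ring] at h1
    rw [show s + 2 * (m + 2) = s + 2 * m + 2 + 2 by ring,
      biperZ_add_two a b c w0 w1 (s + 2 * m + 2), biperZ_add_two a b c 2 b m]
    by_cases hm : Even m <;> by_cases hs : Even s <;>
      simp only [hm, hs, Nat.even_add, Nat.even_mul, even_two, Nat.not_even_one, true_or,
        iff_true, iff_false, not_true, if_true, if_false] at h0 h1 ⊢
    · linear_combination a * h1 + c * h0
    · linear_combination b * h1 + c * h0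
    · linear_combination a * h1 + c * h0
    · linear_combination b * h1 + c * h0

theorem biperZ_lucas_dvd (a b c w0 w1 : ℤ) (m s : ℕ) :
    biperZ a b c 2 b m ∣
      b * (biperZ a b c w0 w1 (s + 2 * m) + (-c) ^ m * biperZ a b c w0 w1 s) := by
  rw [biperZ_lucas_mul]
  exact (dvd_mul_right _ _).mul_left _

theorem stmt12 (a b c w0 w1 : ℤ) (ha : 0 < a) (hb : 0 < b) (hc : 0 < c)
    (m n r : ℕ) (hm : 0 < m) (hn : 0 < n) (hr : 0 < r) :
    biperZ a b c 2 b m ∣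
      b ^ n * (biperZ a b c w0 w1 (2 * m * n + r)
        - (-1) ^ ((m + 1) * n) * c ^ (m * n) * biperZ a b c w0 w1 r) := by
  clear hn
  induction n with
  | zero => simp
  | succ n ih =>
    obtain ⟨x, hx⟩ := biperZ_lucas_dvd a b c w0 w1 m (2 * m * n + r)
    obtain ⟨y, hy⟩ := ih
    refine ⟨b ^ n * x - b * (-c) ^ m * y, ?_⟩
    rw [neg_pow c m] at hx ⊢
    rw [show 2 * m * (n + 1) + r = 2 * m * n + r + 2 * m by ring]
    linear_combination b ^ n * hx - b * ((-1) ^ m * c ^ m) * hy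
end

section
/- Let a, b, c be positive real numbers, set α = (ab + √(a²b² + 4abc))/2 and β = (ab − √(a²b² + 4abc))/2, and let {v_n} be the bi-periodic Lucas sequence. Then for all integers m, r > 0 and for z equal to either α or β, −(−abc)^{m+r} + a^{⌈r/2⌉}·b^{⌊r/2⌋}·v_r·(−abc)^m·z^r + z^{2(m+r)} = a^{⌈m/2⌉}·b^{⌊m/2⌋}·v_m·z^{m+2r}. -/
/-- Binet formula for the bi-periodic Lucas sequence. -/
theorem biper_lucas_binet (a b c x y : ℝ) (hs : x + y = a * b) (hp : x * y = -(a * b * c))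
    (n : ℕ) :
    a ^ ((n + 1) / 2) * b ^ (n / 2) * biper a b c 2 b n = x ^ n + y ^ n := by
  induction n using Nat.twoStepInduction with
  | zero => norm_num [biper]
  | one => simp [biper, hs]
  | more n ih₀ ih₁ =>
    have hrec : x ^ (n + 2) + y ^ (n + 2)
        = a * b * (x ^ (n + 1) + y ^ (n + 1)) + a * b * c * (x ^ n + y ^ n) := by
      linear_combination (x ^ (n + 1) + y ^ (n + 1)) * hs - (x ^ n + y ^ n) * hp
    rw [hrec, ← ih₀, ← ih₁, biper]
    rcases Nat.even_or_odd' n with ⟨k, rfl | rfl⟩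
    · rw [if_pos ⟨k + 1, by ring⟩, show (2 * k + 2 + 1) / 2 = k + 1 by lia,
        show (2 * k + 2) / 2 = k + 1 by lia, show (2 * k + 1) / 2 = k by lia,
        show 2 * k / 2 = k by lia]
      ring
    · rw [if_neg (by simp [parity_simps]), show (2 * k + 1 + 2 + 1) / 2 = k + 2 by lia,
        show (2 * k + 1 + 2) / 2 = k + 1 by lia, show (2 * k + 1 + 1) / 2 = k + 1 by lia,
        show (2 * k + 1) / 2 = k by lia]
      ring

theorem stmt13 (a b c : ℝ) (ha : 0 < a) (hb : 0 < b) (hc : 0 < c)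
    (α β : ℝ)
    (hα : α = (a * b + Real.sqrt (a ^ 2 * b ^ 2 + 4 * a * b * c)) / 2)
    (hβ : β = (a * b - Real.sqrt (a ^ 2 * b ^ 2 + 4 * a * b * c)) / 2)
    (m r : ℕ) (hm : 0 < m) (hr : 0 < r)
    (z : ℝ) (hz : z = α ∨ z = β) :
    -(-(a * b * c)) ^ (m + r)
      + a ^ ((r + 1) / 2) * b ^ (r / 2) * biper a b c 2 b r
          * (-(a * b * c)) ^ m * z ^ r
      + z ^ (2 * (m + r)) =
    a ^ ((m + 1) / 2) * b ^ (m / 2) * biper a b c 2 b m * z ^ (m + 2 * r) := by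
  have hD : 0 ≤ a ^ 2 * b ^ 2 + 4 * a * b * c := by positivity
  have hs : α + β = a * b := by rw [hα, hβ]; ring
  have hp : α * β = -(a * b * c) := by
    rw [hα, hβ]
    linear_combination -(Real.sq_sqrt hD) / 4
  obtain ⟨w, hs', hp'⟩ : ∃ w, z + w = a * b ∧ z * w = -(a * b * c) := by
    rcases hz with rfl | rfl
    · exact ⟨β, hs, hp⟩
    · exact ⟨α, by rw [add_comm, hs], by rw [mul_comm, hp]⟩
  rw [biper_lucas_binet a b c z w hs' hp' r, biper_lucas_binet a b c z w hs' hp' m, ← hp']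
  ring
end

section
/- Let a, b, c be positive real numbers, let {w_n} be the bi-periodic Horadam sequence with initial values w_0, w_1, and let {v_n} be the bi-periodic Lucas sequence. Then for all integers n, m, r > 0, −(−c)^{m+r}·w_n + (−c)^m·(a/b)^{ξ(r)·ξ(n+1)}·v_r·w_{r+n} + w_{2(m+r)+n} = (a/b)^{ξ(m)·ξ(n+1)}·v_m·w_{m+2r+n}. -/
theorem xi_add_two_mul (n k : ℕ) : xi (n + 2 * k) = xi n := by
  simp [xi]

/-- The Lucas factor satisfies a Horadam-type recurrence whose coefficient is governed by the
parity of `n`. -/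
theorem lucas_factor_add_two (a b c : ℝ) (ha : a ≠ 0) (hb : b ≠ 0) (k n : ℕ) :
    (a / b) ^ (xi (k + 2) * xi (n + 1)) * biper a b c 2 b (k + 2) =
      (if Even n then a else b) *
          ((a / b) ^ (xi (k + 1) * xi (n + 2)) * biper a b c 2 b (k + 1))
        + c * ((a / b) ^ (xi k * xi (n + 1)) * biper a b c 2 b k) := by
  rw [biper_add_two]
  rcases Nat.mod_two_eq_zero_or_one k with hk | hk <;>
    rcases Nat.mod_two_eq_zero_or_one n with hn | hn <;>
    simp [xi, Nat.even_iff, Nat.add_mod, hk, hn] <;> field_simp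

theorem biper_add_neg_pow_mul (a b c w0 w1 : ℝ) (ha : a ≠ 0) (hb : b ≠ 0) (k n : ℕ) :
    biper a b c w0 w1 (2 * k + n) + (-c) ^ k * biper a b c w0 w1 n =
      (a / b) ^ (xi k * xi (n + 1)) * biper a b c 2 b k * biper a b c w0 w1 (k + n) := by
  induction k using Nat.twoStepInduction generalizing n with
  | zero => simp [xi, biper]; ring
  | one =>
    rw [show 2 * 1 + n = n + 2 by ring, biper_add_two, add_comm 1 n]
    rcases Nat.mod_two_eq_zero_or_one n with hn | hn <;>
      simp [xi, biper, Nat.even_iff, Nat.add_mod, hn]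
    field_simp
    simp
  | more k ih₀ ih₁ =>
    have h₀ := ih₀ (n + 2)
    have h₁ := ih₁ (n + 1)
    have hw := biper_add_two a b c w0 w1 n
    have hw' := biper_add_two a b c w0 w1 (2 * k + n + 2)
    have hpar : Even (2 * k + n + 2) ↔ Even n := by simp [Nat.even_add]
    rw [lucas_factor_add_two a b c ha hb]
    simp only [hpar] at hw'
    rw [show n + 2 + 1 = n + 1 + 2 * 1 by ring, xi_add_two_mul,
      show 2 * k + (n + 2) = 2 * k + n + 2 by ring,
      show k + (n + 2) = k + 2 + n by ring] at h₀
    rw [show 2 * (k + 1) + (n + 1) = 2 * k + n + 2 + 1 by ring,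
      show k + 1 + (n + 1) = k + 2 + n by ring] at h₁
    rw [show 2 * (k + 2) + n = 2 * k + n + 2 + 2 by ring, hw']
    linear_combination (if Even n then a else b) * h₁ + c * h₀ - c * (-c) ^ k * hw

theorem stmt14 (a b c w0 w1 : ℝ) (ha : 0 < a) (hb : 0 < b) (hc : 0 < c)
    (n m r : ℕ) (hn : 0 < n) (hm : 0 < m) (hr : 0 < r) :
    -(-c) ^ (m + r) * biper a b c w0 w1 n
      + (-c) ^ m * (a / b) ^ (xi r * xi (n + 1)) * biper a b c 2 b r
          * biper a b c w0 w1 (r + n)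
      + biper a b c w0 w1 (2 * (m + r) + n) =
    (a / b) ^ (xi m * xi (n + 1)) * biper a b c 2 b m
      * biper a b c w0 w1 (m + 2 * r + n) := by
  have hmr := biper_add_neg_pow_mul a b c w0 w1 ha.ne' hb.ne' m (2 * r + n)
  have hrn := biper_add_neg_pow_mul a b c w0 w1 ha.ne' hb.ne' r n
  rw [show 2 * r + n + 1 = n + 1 + 2 * r by ring, xi_add_two_mul,
    show 2 * m + (2 * r + n) = 2 * (m + r) + n by ring, ← add_assoc] at hmr
  linear_combination hmr - (-c) ^ m * hrn
end
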